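/- Let P and Q be standard parabolic submonoids of M (satisfying Assumption 1), let g ∈ M and k > 0 be such that (Δ_P^k)^g is defined and lies in Q. Then T_P(g) is a P-ribbon and P^{T_P(g)} ⊆ Q. If in addition (Δ_P^k)^g = Δ_Q^k, then P^{T_P(g)} = Q. -/

import Mathlib

/-!
Common setting: Garside monoids, standard parabolic submonoids, heads,
ribbons, following Digne–Michel, "Ribbons in Garside monoids".
-/

namespace GarsidePaper

variable {M : Type*}

/-- `a` left-divides `b` : `b = a * c` for some `c`. -/
def LDvd [Monoid M] (a b : M) : Prop := ∃ c, b = a * c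

/-- `a` right-divides `b` : `b = c * a` for some `c`. -/
def RDvd [Monoid M] (a b : M) : Prop := ∃ c, b = c * a

/-- `a` is a factor of `b` : `a` left-divides a right-divisor of `b`. -/
def IsFactor [Monoid M] (a b : M) : Prop := ∃ c, LDvd a c ∧ RDvd c b

/-- A Garside structure on a (left- and right-) cancellative monoid `M`:
left/right gcds and lcms, Noetherianity, and a Garside element `Δ`. -/
structure GarsideStruct (M : Type*) [CancelMonoid M] where
  /-- left-gcd : gcd for the left-divisibility order -/
  lgcd : M → M → M
  lgcd_dvd_left : ∀ a b, LDvd (lgcd a b) a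
  lgcd_dvd_right : ∀ a b, LDvd (lgcd a b) b
  lgcd_greatest : ∀ a b d, LDvd d a → LDvd d b → LDvd d (lgcd a b)
  /-- right-lcm : lcm for the left-divisibility order -/
  rlcm : M → M → M
  ldvd_rlcm_left : ∀ a b, LDvd a (rlcm a b)
  ldvd_rlcm_right : ∀ a b, LDvd b (rlcm a b)
  rlcm_least : ∀ a b m, LDvd a m → LDvd b m → LDvd (rlcm a b) m
  /-- right-gcd : gcd for the right-divisibility order -/
  rgcd : M → M → M
  rgcd_dvd_left : ∀ a b, RDvd (rgcd a b) a
  rgcd_dvd_right : ∀ a b, RDvd (rgcd a b) b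
  rgcd_greatest : ∀ a b d, RDvd d a → RDvd d b → RDvd d (rgcd a b)
  /-- left-lcm : lcm for the right-divisibility order -/
  llcm : M → M → M
  rdvd_llcm_left : ∀ a b, RDvd a (llcm a b)
  rdvd_llcm_right : ∀ a b, RDvd b (llcm a b)
  llcm_least : ∀ a b m, RDvd a m → RDvd b m → RDvd (llcm a b) m
  /-- Noetherian: no infinite sequence where each term is a proper factor
  of the previous one. -/
  noetherian : WellFounded (fun a b : M => IsFactor a b ∧ a ≠ b)
  /-- the Garside element -/
  Δ : M
  /-- the left- and right-divisors of `Δ` coincide -/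
  delta_balanced : ∀ a : M, LDvd a Δ ↔ RDvd a Δ
  /-- the divisors of `Δ` generate `M` -/
  delta_generates : Submonoid.closure {a : M | LDvd a Δ} = ⊤

variable [CancelMonoid M]

/-- An atom: an element with no proper nontrivial divisor (factor). -/
def IsAtom' (a : M) : Prop := a ≠ 1 ∧ ∀ b : M, IsFactor b a → b = 1 ∨ b = a

/-- A standard parabolic submonoid: a submonoid closed under factors in which
every element of `M` has a maximal left-divisor (the left `P`-head) and a
maximal right-divisor (the right `P`-head) lying in `P`. -/
structure IsStdParabolic (P : Submonoid M) : Prop where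
  factor_closed : ∀ a b : M, b ∈ P → IsFactor a b → a ∈ P
  exists_left_head : ∀ g : M, ∃ h, h ∈ P ∧ LDvd h g ∧
    ∀ h', h' ∈ P → LDvd h' g → LDvd h' h
  exists_right_head : ∀ g : M, ∃ h, h ∈ P ∧ RDvd h g ∧
    ∀ h', h' ∈ P → RDvd h' g → RDvd h' h

/-- `h` is the left `P`-head `H_P g` of `g` : the maximal left-divisor of `g`
lying in `P`. -/
def IsLeftHead (P : Set M) (g h : M) : Prop :=
  h ∈ P ∧ LDvd h g ∧ ∀ h', h' ∈ P → LDvd h' g → LDvd h' h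

/-- `h` is the right `P`-head of `g` : the maximal right-divisor of `g`
lying in `P`. -/
def IsRightHead (P : Set M) (g h : M) : Prop :=
  h ∈ P ∧ RDvd h g ∧ ∀ h', h' ∈ P → RDvd h' g → RDvd h' h

/-- `g` is `P`-reduced : `H_P g = 1`, i.e. the only left-divisor of `g`
lying in `P` is `1`. -/
def PReduced (P : Set M) (g : M) : Prop := ∀ h ∈ P, LDvd h g → h = 1

/-- `P ^ g` is defined: `p ^ g` is defined (`g ≼ p * g`) for every `p ∈ P`. -/
def ConjSetDef (P : Set M) (g : M) : Prop := ∀ p ∈ P, LDvd g (p * g)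

/-- The set `P ^ g = { p ^ g : p ∈ P }`, where `p ^ g` is the unique `c`
with `p * g = g * c`. -/
def conjSet (P : Set M) (g : M) : Set M := {c : M | ∃ p ∈ P, p * g = g * c}

/-- A `P`-ribbon: a `P`-reduced element `g` such that `P ^ g` is defined. -/
def IsRibbon (P : Set M) (g : M) : Prop := PReduced P g ∧ ConjSetDef P g

/-- `P` is the smallest standard parabolic submonoid containing `S₁`. -/
def IsSmallestParabolicContaining (S₁ : Set M) (P : Submonoid M) : Prop :=
  IsStdParabolic P ∧ S₁ ⊆ (P : Set M) ∧
    ∀ Q : Submonoid M, IsStdParabolic Q → S₁ ⊆ (Q : Set M) → P ≤ Q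

/-- Assumption 1: for any set `S₁` of atoms, the right-lcm of `S₁` is the
Garside element `Δ_{P₁} = H_{P₁}(Δ)` of the smallest standard parabolic
submonoid `P₁` containing `S₁`. -/
def Assumption1 (G : GarsideStruct M) : Prop :=
  ∀ S₁ : Set M, (∀ s ∈ S₁, IsAtom' s) →
    ∀ P₁ : Submonoid M, IsSmallestParabolicContaining S₁ P₁ →
      ∀ d : M, IsLeftHead (P₁ : Set M) G.Δ d →
        (∀ s ∈ S₁, LDvd s d) ∧ ∀ m : M, (∀ s ∈ S₁, LDvd s m) → LDvd d m

/-- Assumption 2: some (positive) power of `Δ` is central. -/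
def Assumption2 (G : GarsideStruct M) : Prop :=
  ∃ n : ℕ, 0 < n ∧ ∀ x : M, G.Δ ^ n * x = x * G.Δ ^ n

/-- `v = v_{s,P}` : the element defined by `Δ_{P_s} = Δ_P * v`, where `P_s`
is the smallest standard parabolic submonoid containing `P` and `s`. -/
def IsVsp (G : GarsideStruct M) (P : Submonoid M) (s v : M) : Prop :=
  ∃ Ps : Submonoid M, IsSmallestParabolicContaining ((P : Set M) ∪ {s}) Ps ∧
    ∃ dP dPs : M, IsLeftHead (P : Set M) G.Δ dP ∧
      IsLeftHead (Ps : Set M) G.Δ dPs ∧ dPs = dP * v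

section Divisibility

theorem LDvd.trans {a b c : M} (hab : LDvd a b) (hbc : LDvd b c) : LDvd a c := by
  obtain ⟨u, rfl⟩ := hab
  obtain ⟨v, rfl⟩ := hbc
  exact ⟨u * v, mul_assoc _ _ _⟩

theorem ldvd_mul_right (a b : M) : LDvd a (a * b) := ⟨b, rfl⟩

theorem LDvd.mul_left {a b : M} (h : LDvd a b) (c : M) : LDvd (c * a) (c * b) := by
  obtain ⟨u, rfl⟩ := h
  exact ⟨u, (mul_assoc _ _ _).symm⟩

theorem LDvd.of_mul_left {a b c : M} (h : LDvd (c * a) (c * b)) : LDvd a b := by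
  obtain ⟨u, hu⟩ := h
  exact ⟨u, mul_left_cancel (a := c) (by rw [hu, mul_assoc])⟩

theorem LDvd.isFactor {a b : M} (h : LDvd a b) : IsFactor a b :=
  ⟨b, h, 1, (one_mul b).symm⟩

theorem RDvd.isFactor {a b : M} (h : RDvd a b) : IsFactor a b :=
  ⟨a, ⟨1, (mul_one a).symm⟩, h⟩

end Divisibility

namespace GarsideStruct

theorem isFactor_antisymm (G : GarsideStruct M) {a b : M} (hab : IsFactor a b)
    (hba : IsFactor b a) : a = b := by
  by_contra hne
  exact G.noetherian.asymmetric _ _ ⟨hab, hne⟩ ⟨hba, Ne.symm hne⟩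

theorem eq_one_of_mul_eq_one_left (G : GarsideStruct M) {a b : M} (h : a * b = 1) : a = 1 :=
  G.isFactor_antisymm (LDvd.isFactor ⟨b, h.symm⟩) (LDvd.isFactor ⟨a, (one_mul a).symm⟩)

theorem eq_one_of_mul_ldvd_self (G : GarsideStruct M) {a b : M} (h : LDvd (a * b) a) : b = 1 := by
  obtain ⟨u, hu⟩ := h
  refine G.eq_one_of_mul_eq_one_left (b := u) (mul_left_cancel (a := a) ?_)
  rw [← mul_assoc, ← hu, mul_one]

theorem induction_proper_factor (G : GarsideStruct M) {p : M → Prop}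
    (h : ∀ a, (∀ b, IsFactor b a → b ≠ a → p b) → p a) (a : M) : p a :=
  G.noetherian.induction a fun x ih => h x fun b hb hne => ih b ⟨hb, hne⟩

theorem exists_atom_ldvd (G : GarsideStruct M) (t : M)
    (ht : t ≠ 1) : ∃ r, IsAtom' r ∧ LDvd r t := by
  induction t using G.induction_proper_factor with
  | h t ih =>
  by_cases hat : IsAtom' t
  · exact ⟨t, hat, 1, (mul_one t).symm⟩
  have hex : ∃ b, IsFactor b t ∧ b ≠ 1 ∧ b ≠ t := by
    by_contra! hno
    exact hat ⟨ht, fun b hb => or_iff_not_imp_left.2 (hno b hb)⟩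
  suffices ∃ x, LDvd x t ∧ x ≠ 1 ∧ x ≠ t by
    obtain ⟨x, hxt, hx1, hne⟩ := this
    obtain ⟨r, hr, hrx⟩ := ih x hxt.isFactor hne hx1
    exact ⟨r, hr, hrx.trans hxt⟩
  obtain ⟨b, ⟨_, ⟨y, rfl⟩, x, hx⟩, hb1, hbt⟩ := hex
  by_cases hx1 : x = 1
  · exact ⟨b, ⟨y, by rw [hx, hx1, one_mul]⟩, hb1, hbt⟩
  · refine ⟨x, ⟨_, hx⟩, hx1, fun hxt => hb1 ?_⟩
    refine G.eq_one_of_mul_eq_one_left (b := y) (mul_left_cancel (a := x) ?_)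
    rw [← hx, hxt, mul_one]

theorem mem_of_atoms_mem (G : GarsideStruct M) {P R : Submonoid M} (hP : IsStdParabolic P)
    (h : ∀ s, IsAtom' s → s ∈ P → s ∈ R) (x : M) (hx : x ∈ P) : x ∈ R := by
  induction x using G.induction_proper_factor with
  | h x ih =>
  by_cases hx1 : x = 1
  · exact hx1 ▸ R.one_mem
  obtain ⟨r, hr, y, rfl⟩ := G.exists_atom_ldvd x hx1
  have hy : IsFactor y (r * y) := RDvd.isFactor ⟨r, rfl⟩
  refine R.mul_mem (h r hr (hP.factor_closed _ _ hx (LDvd.isFactor ⟨y, rfl⟩)))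
    (ih y hy (fun he => hr.1 ?_) (hP.factor_closed _ _ hx hy))
  exact mul_right_cancel (b := y) (by rw [← he, one_mul])

theorem isStdParabolic_of_lcm_mem (G : GarsideStruct M) {P : Submonoid M}
    (hf : ∀ a b : M, b ∈ P → IsFactor a b → a ∈ P)
    (hr : ∀ a ∈ P, ∀ b ∈ P, G.rlcm a b ∈ P) (hl : ∀ a ∈ P, ∀ b ∈ P, G.llcm a b ∈ P) :
    IsStdParabolic P := by
  refine ⟨hf, fun g => ?_, fun g => ?_⟩
  · obtain ⟨b, ⟨a, ha, rfl⟩, hmin⟩ := G.noetherian.has_min {b | ∃ a ∈ P, g = a * b}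
      ⟨g, 1, P.one_mem, (one_mul g).symm⟩
    refine ⟨a, ha, ⟨b, rfl⟩, fun a' ha' h' => ?_⟩
    obtain ⟨w, hw⟩ := G.rlcm_least a a' _ ⟨b, rfl⟩ h'
    obtain ⟨u, hu⟩ := G.ldvd_rlcm_left a a'
    have hb : b = u * w := mul_left_cancel (a := a) (by rw [hw, hu, mul_assoc])
    have hwb : w = b := by
      by_contra hne
      exact hmin w ⟨_, hr a ha a' ha', hw⟩ ⟨RDvd.isFactor ⟨u, hb⟩, hne⟩
    have haa : G.rlcm a a' = a := mul_right_cancel (b := b) (by rw [hw, hwb])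
    exact haa ▸ G.ldvd_rlcm_right a a'
  · obtain ⟨b, ⟨a, ha, rfl⟩, hmin⟩ := G.noetherian.has_min {b | ∃ a ∈ P, g = b * a}
      ⟨g, 1, P.one_mem, (mul_one g).symm⟩
    refine ⟨a, ha, ⟨b, rfl⟩, fun a' ha' h' => ?_⟩
    obtain ⟨w, hw⟩ := G.llcm_least a a' _ ⟨b, rfl⟩ h'
    obtain ⟨u, hu⟩ := G.rdvd_llcm_left a a'
    have hb : b = w * u := mul_right_cancel (b := a) (by rw [hw, hu, mul_assoc])
    have hwb : w = b := by
      by_contra hne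
      exact hmin w ⟨_, hl a ha a' ha', hw⟩ ⟨LDvd.isFactor ⟨u, hb⟩, hne⟩
    have haa : G.llcm a a' = a := mul_left_cancel (a := b) (by rw [hw, hwb])
    exact haa ▸ G.rdvd_llcm_right a a'

theorem rlcm_mem (G : GarsideStruct M) {P : Submonoid M} (hP : IsStdParabolic P) {a b : M}
    (ha : a ∈ P) (hb : b ∈ P) :
    G.rlcm a b ∈ P := by
  obtain ⟨h, hh, -, hmax⟩ := hP.exists_left_head (G.rlcm a b)
  exact hP.factor_closed _ _ hh (G.rlcm_least a b h (hmax a ha (G.ldvd_rlcm_left a b))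
    (hmax b hb (G.ldvd_rlcm_right a b))).isFactor

theorem llcm_mem (G : GarsideStruct M) {P : Submonoid M} (hP : IsStdParabolic P) {a b : M}
    (ha : a ∈ P) (hb : b ∈ P) :
    G.llcm a b ∈ P := by
  obtain ⟨h, hh, -, hmax⟩ := hP.exists_right_head (G.llcm a b)
  exact hP.factor_closed _ _ hh (G.llcm_least a b h (hmax a ha (G.rdvd_llcm_left a b))
    (hmax b hb (G.rdvd_llcm_right a b))).isFactor

theorem exists_isSmallestParabolicContaining (G : GarsideStruct M) (S : Set M) :
    ∃ R : Submonoid M, IsSmallestParabolicContaining S R := by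
  refine ⟨sInf {Q | IsStdParabolic Q ∧ S ⊆ Q}, G.isStdParabolic_of_lcm_mem ?_ ?_ ?_, ?_, ?_⟩
  · intro a b hb hab
    rw [Submonoid.mem_sInf] at hb ⊢
    exact fun Q hQ => hQ.1.factor_closed a b (hb Q hQ) hab
  · intro a ha b hb
    rw [Submonoid.mem_sInf] at ha hb ⊢
    exact fun Q hQ => G.rlcm_mem hQ.1 (ha Q hQ) (hb Q hQ)
  · intro a ha b hb
    rw [Submonoid.mem_sInf] at ha hb ⊢
    exact fun Q hQ => G.llcm_mem hQ.1 (ha Q hQ) (hb Q hQ)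
  · exact fun s hs => Submonoid.mem_sInf.2 fun Q hQ => hQ.2 hs
  · exact fun Q hQ hS => sInf_le ⟨hQ, hS⟩

end GarsideStruct

section Head

variable {G : GarsideStruct M} {P : Submonoid M} {d : M}

theorem IsLeftHead.ldvd_of_rdvd (hP : IsStdParabolic P) (hd : IsLeftHead (P : Set M) G.Δ d) {a : M}
    (ha : RDvd a d) : LDvd a d := by
  refine hd.2.2 a (hP.factor_closed a d hd.1 ha.isFactor) ?_
  obtain ⟨b, rfl⟩ := ha
  obtain ⟨e, he⟩ := hd.2.1
  exact (ldvd_mul_right a e).trans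
    ((G.delta_balanced (a * e)).2 ⟨b, by rw [he, mul_assoc]⟩)

theorem IsLeftHead.rdvd_of_ldvd (hP : IsStdParabolic P) (hd : IsLeftHead (P : Set M) G.Δ d) {a : M}
    (ha : LDvd a d) : RDvd a d := by
  obtain ⟨e, he, heΔ, hmax⟩ := hP.exists_right_head G.Δ
  have hde : RDvd d e := hmax d hd.1 ((G.delta_balanced d).1 hd.2.1)
  have hed : LDvd e d := hd.2.2 e he ((G.delta_balanced e).2 heΔ)
  have heq : d = e := G.isFactor_antisymm hde.isFactor hed.isFactor
  rw [heq]
  exact hmax a (hP.factor_closed a d hd.1 ha.isFactor)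
    ((G.delta_balanced a).1 (ha.trans hd.2.1))

/-- To prove a multiplicative property of the elements of `P`, it suffices to prove it for
the left-divisors of `Δ_P`. -/
theorem IsLeftHead.induction (hP : IsStdParabolic P) (hd : IsLeftHead (P : Set M) G.Δ d)
    {p : M → Prop} (one : p 1) (mem : ∀ a, LDvd a d → p a)
    (mul : ∀ a ∈ P, ∀ b ∈ P, p a → p b → p (a * b)) {x : M} (hx : x ∈ P) : p x := by
  have hmem : x ∈ Submonoid.closure {a : M | LDvd a G.Δ} := G.delta_generates ▸ Submonoid.mem_top x
  induction hmem using Submonoid.closure_induction with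
  | mem a ha => exact mem a (hd.2.2 a hx ha)
  | one => exact one
  | mul a b _ _ iha ihb =>
    have ha := hP.factor_closed a _ hx (LDvd.isFactor ⟨b, rfl⟩)
    have hb := hP.factor_closed b _ hx (RDvd.isFactor ⟨a, rfl⟩)
    exact mul a ha b hb (iha ha) (ihb hb)

theorem IsLeftHead.exists_conj (hP : IsStdParabolic P) (hd : IsLeftHead (P : Set M) G.Δ d) {a : M}
    (ha : a ∈ P) : ∃ b ∈ P, a * d = d * b := by
  refine hd.induction hP (p := fun a => ∃ b ∈ P, a * d = d * b)
    ⟨1, P.one_mem, by simp⟩ ?_ ?_ ha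
  · rintro a ⟨b, hb⟩
    obtain ⟨a', ha'⟩ := hd.ldvd_of_rdvd hP ⟨a, hb⟩
    refine ⟨a', hP.factor_closed _ _ hd.1 (RDvd.isFactor ⟨b, ha'⟩), ?_⟩
    conv_lhs => rw [ha', ← mul_assoc, ← hb]
  · rintro a - b - ⟨a', ha', haa⟩ ⟨b', hb', hbb⟩
    exact ⟨a' * b', P.mul_mem ha' hb', by rw [mul_assoc, hbb, ← mul_assoc, haa, mul_assoc]⟩

theorem IsLeftHead.exists_conj_inv (hP : IsStdParabolic P) (hd : IsLeftHead (P : Set M) G.Δ d)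
    {a : M} (ha : a ∈ P) : ∃ b ∈ P, b * d = d * a := by
  refine hd.induction hP (p := fun a => ∃ b ∈ P, b * d = d * a)
    ⟨1, P.one_mem, by simp⟩ ?_ ?_ ha
  · intro a ha
    obtain ⟨b, hb⟩ := hd.rdvd_of_ldvd hP ha
    obtain ⟨a', ha'⟩ := hd.rdvd_of_ldvd hP ⟨a, hb⟩
    refine ⟨a', hP.factor_closed _ _ hd.1 (LDvd.isFactor ⟨b, ha'⟩), ?_⟩
    conv_rhs => rw [ha', mul_assoc, ← hb]
  · rintro a - b - ⟨a', ha', haa⟩ ⟨b', hb', hbb⟩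
    exact ⟨a' * b', P.mul_mem ha' hb', by rw [mul_assoc, hbb, ← mul_assoc, haa, mul_assoc]⟩

theorem IsLeftHead.exists_conj_pow (hP : IsStdParabolic P) (hd : IsLeftHead (P : Set M) G.Δ d)
    (n : ℕ) {a : M} (ha : a ∈ P) : ∃ b ∈ P, a * d ^ n = d ^ n * b := by
  induction n with
  | zero => exact ⟨a, ha, by simp⟩
  | succ n ih =>
    obtain ⟨b, hb, hab⟩ := ih
    obtain ⟨c, hc, hbc⟩ := hd.exists_conj hP hb
    exact ⟨c, hc, by rw [pow_succ, ← mul_assoc, hab, mul_assoc, hbc, mul_assoc]⟩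

theorem IsLeftHead.exists_ldvd_pow (hP : IsStdParabolic P) (hd : IsLeftHead (P : Set M) G.Δ d)
    {a : M} (ha : a ∈ P) : ∃ n : ℕ, LDvd a (d ^ n) := by
  refine hd.induction hP (p := fun a => ∃ n : ℕ, LDvd a (d ^ n))
    ⟨0, 1, by simp⟩ (fun a ha => ⟨1, by simpa using ha⟩) ?_ ha
  rintro a - b - ⟨m, u, hu⟩ ⟨n, hn⟩
  have huP : u ∈ P := hP.factor_closed _ _ (P.pow_mem hd.1 m) (RDvd.isFactor ⟨a, hu⟩)
  obtain ⟨u', -, huu⟩ := hd.exists_conj_pow hP n huP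
  refine ⟨m + n, (hn.mul_left a).trans ⟨u', ?_⟩⟩
  rw [pow_add, hu, mul_assoc, huu, mul_assoc]

theorem IsLeftHead.le_of_mem (hP : IsStdParabolic P) (hd : IsLeftHead (P : Set M) G.Δ d)
    {R : Submonoid M} (hR : IsStdParabolic R) (hdR : d ∈ R) : P ≤ R := fun x hx => by
  obtain ⟨n, hn⟩ := hd.exists_ldvd_pow hP hx
  exact hR.factor_closed _ _ (R.pow_mem hdR n) hn.isFactor

theorem IsLeftHead.pReduced_tail {g h t : M} (G : GarsideStruct M)
    (hh : IsLeftHead (P : Set M) g h) (ht : g = h * t) : PReduced (P : Set M) t := by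
  intro p hp hpt
  exact G.eq_one_of_mul_ldvd_self (hh.2.2 _ (P.mul_mem hh.1 hp) (ht ▸ hpt.mul_left h))

end Head

/-- `P ^ g`, as a submonoid. -/
def conjSubmonoid (P : Submonoid M) (g : M) : Submonoid M where
  carrier := conjSet (P : Set M) g
  one_mem' := ⟨1, P.one_mem, by simp⟩
  mul_mem' := by
    rintro a b ⟨p, hp, hpa⟩ ⟨q, hq, hqb⟩
    exact ⟨p * q, P.mul_mem hp hq, by rw [mul_assoc, hqb, ← mul_assoc, hpa, mul_assoc]⟩

theorem mem_conjSubmonoid {P : Submonoid M} {g c : M} :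
    c ∈ conjSubmonoid P g ↔ ∃ p ∈ P, p * g = g * c := Iff.rfl

section Ribbon

variable {G : GarsideStruct M} {P R : Submonoid M} {d e v : M}

theorem conjSubmonoid_le_of_isLeftHead (hR : IsStdParabolic R) (he : IsLeftHead (R : Set M) G.Δ e)
    (hPR : P ≤ R) : conjSubmonoid P e ≤ R := by
  rintro c ⟨p, hp, hpc⟩
  obtain ⟨c', hc', hpc'⟩ := he.exists_conj hR (hPR hp)
  exact mul_left_cancel (hpc.symm.trans hpc') ▸ hc'

theorem isStdParabolic_conjSubmonoid (hP : IsStdParabolic P) (hR : IsStdParabolic R)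
    (he : IsLeftHead (R : Set M) G.Δ e) (hPR : P ≤ R) : IsStdParabolic (conjSubmonoid P e) := by
  have hf : ∀ a b : M, b ∈ conjSubmonoid P e → IsFactor a b → a ∈ conjSubmonoid P e := by
    rintro a b hb ⟨_, ⟨y, rfl⟩, x, rfl⟩
    have hbR := conjSubmonoid_le_of_isLeftHead hR he hPR hb
    have hayR := hR.factor_closed (a * y) _ hbR (RDvd.isFactor ⟨x, rfl⟩)
    obtain ⟨x', -, hx⟩ := he.exists_conj_inv hR
      (hR.factor_closed x _ hbR (LDvd.isFactor ⟨a * y, rfl⟩))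
    obtain ⟨a', -, ha⟩ := he.exists_conj_inv hR
      (hR.factor_closed a _ hayR (LDvd.isFactor ⟨y, rfl⟩))
    obtain ⟨y', -, hy⟩ := he.exists_conj_inv hR
      (hR.factor_closed y _ hayR (RDvd.isFactor ⟨a, rfl⟩))
    obtain ⟨p, hp, hpb⟩ := hb
    have hpe : p = x' * (a' * y') := mul_right_cancel (b := e) <| by
      rw [hpb, mul_assoc, mul_assoc, hy, ← mul_assoc a', ha, ← mul_assoc e, ← hx]
      simp only [mul_assoc]
    exact ⟨a', hP.factor_closed a' p hp ⟨a' * y', ⟨y', rfl⟩, x', hpe⟩, ha⟩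
  refine G.isStdParabolic_of_lcm_mem hf ?_ ?_
  · rintro a ⟨p, hp, hpa⟩ b ⟨q, hq, hqb⟩
    have hm := G.rlcm_mem hP hp hq
    obtain ⟨m, -, hme⟩ := he.exists_conj hR (hPR hm)
    refine hf _ m ⟨_, hm, hme⟩ (LDvd.isFactor (G.rlcm_least a b m ?_ ?_))
    · obtain ⟨u, hu⟩ := G.ldvd_rlcm_left p q
      obtain ⟨u', -, hu'⟩ :=
        he.exists_conj hR (hPR (hP.factor_closed u _ hm (RDvd.isFactor ⟨p, hu⟩)))
      exact ⟨u', mul_left_cancel (a := e) (by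
        rw [← hme, hu, mul_assoc, hu', ← mul_assoc, hpa, mul_assoc])⟩
    · obtain ⟨u, hu⟩ := G.ldvd_rlcm_right p q
      obtain ⟨u', -, hu'⟩ :=
        he.exists_conj hR (hPR (hP.factor_closed u _ hm (RDvd.isFactor ⟨q, hu⟩)))
      exact ⟨u', mul_left_cancel (a := e) (by
        rw [← hme, hu, mul_assoc, hu', ← mul_assoc, hqb, mul_assoc])⟩
  · rintro a ⟨p, hp, hpa⟩ b ⟨q, hq, hqb⟩
    have hm := G.llcm_mem hP hp hq
    obtain ⟨m, -, hme⟩ := he.exists_conj hR (hPR hm)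
    refine hf _ m ⟨_, hm, hme⟩ (RDvd.isFactor (G.llcm_least a b m ?_ ?_))
    · obtain ⟨u, hu⟩ := G.rdvd_llcm_left p q
      obtain ⟨u', -, hu'⟩ :=
        he.exists_conj hR (hPR (hP.factor_closed u _ hm (LDvd.isFactor ⟨p, hu⟩)))
      exact ⟨u', mul_left_cancel (a := e) (by
        rw [← hme, hu, mul_assoc, hpa, ← mul_assoc, hu', mul_assoc])⟩
    · obtain ⟨u, hu⟩ := G.rdvd_llcm_right p q
      obtain ⟨u', -, hu'⟩ :=
        he.exists_conj hR (hPR (hP.factor_closed u _ hm (LDvd.isFactor ⟨q, hu⟩)))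
      exact ⟨u', mul_left_cancel (a := e) (by
        rw [← hme, hu, mul_assoc, hqb, ← mul_assoc, hu', mul_assoc])⟩

/-- Conjugating `P` by `Δ_R = Δ_P * v` amounts to conjugating it by `v`. -/
theorem conjSubmonoid_head_mul (hP : IsStdParabolic P) (hd : IsLeftHead (P : Set M) G.Δ d) (v : M) :
    conjSubmonoid P (d * v) = conjSubmonoid P v := by
  ext c
  constructor
  · rintro ⟨p, hp, hpc⟩
    obtain ⟨p', hp', hpp⟩ := hd.exists_conj hP hp
    refine ⟨p', hp', mul_left_cancel (a := d) ?_⟩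
    rw [← mul_assoc, ← hpp, mul_assoc, hpc, mul_assoc]
  · rintro ⟨p, hp, hpc⟩
    obtain ⟨p', hp', hpp⟩ := hd.exists_conj_inv hP hp
    exact ⟨p', hp', by rw [← mul_assoc, hpp, mul_assoc, hpc, mul_assoc]⟩

theorem isRibbon_of_head_mul (hP : IsStdParabolic P) (hR : IsStdParabolic R)
    (hd : IsLeftHead (P : Set M) G.Δ d) (he : IsLeftHead (R : Set M) G.Δ (d * v)) (hPR : P ≤ R) :
    IsRibbon (P : Set M) v := by
  refine ⟨fun p hp hpv => ?_, fun p hp => ?_⟩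
  · exact G.eq_one_of_mul_ldvd_self
      (hd.2.2 _ (P.mul_mem hd.1 hp) ((hpv.mul_left d).trans he.2.1))
  · obtain ⟨p', hp', hpp⟩ := hd.exists_conj_inv hP hp
    obtain ⟨c, -, hc⟩ := he.exists_conj hR (hPR hp')
    refine ⟨c, mul_left_cancel (a := d) ?_⟩
    rw [← mul_assoc, ← hpp, mul_assoc, hc, mul_assoc]

theorem isLeftHead_conjSubmonoid (hP : IsStdParabolic P) (hR : IsStdParabolic R)
    (hd : IsLeftHead (P : Set M) G.Δ d) (he : IsLeftHead (R : Set M) G.Δ (d * v)) (hPR : P ≤ R)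
    {d' : M} (hd' : d * v = v * d') : IsLeftHead (conjSubmonoid P v : Set M) G.Δ d' := by
  refine ⟨⟨d, hd.1, hd'⟩, (he.ldvd_of_rdvd hR ⟨v, hd'⟩).trans he.2.1, fun q hq hqΔ => ?_⟩
  change q ∈ conjSubmonoid P v at hq
  rw [← conjSubmonoid_head_mul hP hd] at hq
  obtain ⟨u, hu⟩ := he.2.2 q (conjSubmonoid_le_of_isLeftHead hR he hPR hq) hqΔ
  obtain ⟨p, hp, hpq⟩ := hq
  obtain ⟨u', -, hu'⟩ := he.exists_conj_inv hR
    (hR.factor_closed u _ he.1 (RDvd.isFactor ⟨q, hu⟩))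
  have hpu : d * v = p * u' := mul_right_cancel (b := d * v) <| by
    rw [mul_assoc p, hu', ← mul_assoc p, hpq, mul_assoc _ q, ← hu]
  obtain ⟨w, hw⟩ := hd.2.2 p hp (LDvd.trans ⟨u', hpu⟩ he.2.1)
  obtain ⟨w', -, hw'⟩ := he.exists_conj hR
    (hPR (hP.factor_closed w _ hd.1 (RDvd.isFactor ⟨p, hw⟩)))
  refine ⟨w', mul_left_cancel (a := d * v) ?_⟩
  calc d * v * d' = d * (d * v) := by rw [mul_assoc, ← hd']
    _ = p * w * (d * v) := by rw [← hw]
    _ = d * v * (q * w') := by rw [mul_assoc, hw', ← mul_assoc, hpq, mul_assoc]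

/-- If `v` is a `P`-ribbon and `p ∈ P`, then `p * v` is the right-lcm of `p` and `v`. -/
theorem IsRibbon.mul_ldvd (hv : IsRibbon (P : Set M) v) (hPv : IsStdParabolic (conjSubmonoid P v))
    (G : GarsideStruct M) {p z : M} (hp : p ∈ P) (hpz : LDvd p z) (hvz : LDvd v z) :
    LDvd (p * v) z := by
  have hm := G.rlcm_least p v z hpz hvz
  obtain ⟨q, hq⟩ := hv.2 p hp
  obtain ⟨f, hf⟩ := G.ldvd_rlcm_right p v
  obtain ⟨u, hu⟩ : LDvd f q := by
    refine LDvd.of_mul_left (c := v) ?_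
    rw [← hf, ← hq]
    exact G.rlcm_least p v _ ⟨v, rfl⟩ ⟨q, hq⟩
  have hqmem : q ∈ conjSubmonoid P v := ⟨p, hp, hq⟩
  obtain ⟨p₁, hp₁, h₁⟩ := hPv.factor_closed f q hqmem (LDvd.isFactor ⟨u, hu⟩)
  obtain ⟨p₂, hp₂, h₂⟩ := hPv.factor_closed u q hqmem (RDvd.isFactor ⟨f, hu⟩)
  have hpp : p = p₁ * p₂ := mul_right_cancel (b := v) <| by
    rw [hq, hu, ← mul_assoc, ← h₁, mul_assoc, ← h₂, mul_assoc]
  have hp₂v : LDvd p₂ v := LDvd.of_mul_left (c := p₁) <| by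
    rw [← hpp, h₁, ← hf]
    exact G.ldvd_rlcm_left p v
  rw [hpp, hv.1 p₂ hp₂ hp₂v, mul_one, h₁, ← hf]
  exact hm

end Ribbon

/-- A nontrivial `P`-reduced element `t` with `t ≼ x * t` for some multiple `x ∈ P` of `Δ_P`
is left-divisible by a nontrivial ribbon `v` such that `Δ_P * v` is some `Δ_R` with `P ≤ R`. -/
theorem exists_head_mul_ldvd {G : GarsideStruct M} (hA : Assumption1 G) {P : Submonoid M} {d : M}
    (hP : IsStdParabolic P) (hd : IsLeftHead (P : Set M) G.Δ d) {t y : M} (ht : t ≠ 1)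
    (hred : PReduced (P : Set M) t) (hy : y ∈ P) (htx : LDvd t (d * y * t)) :
    ∃ (R : Submonoid M) (v : M), IsStdParabolic R ∧ P ≤ R ∧
      IsLeftHead (R : Set M) G.Δ (d * v) ∧ v ≠ 1 ∧ LDvd v t := by
  obtain ⟨r, hr, hrt⟩ := G.exists_atom_ldvd t ht
  obtain ⟨R, hR⟩ := G.exists_isSmallestParabolicContaining ({s | IsAtom' s ∧ s ∈ P} ∪ {r})
  have hPR : P ≤ R := fun x hx =>
    G.mem_of_atoms_mem hP (fun s hs hsP => hR.2.1 (Or.inl ⟨hs, hsP⟩)) x hx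
  have hrR : r ∈ R := hR.2.1 (Or.inr rfl)
  obtain ⟨e, he⟩ := hR.1.exists_left_head G.Δ
  have hlcm := hA _ (by rintro s (hs | rfl); exacts [hs.1, hr]) R hR e he
  obtain ⟨v, rfl⟩ := he.2.2 d (hPR hd.1) hd.2.1
  have hdvd : LDvd (d * v) (d * y * t) := by
    refine hlcm.2 _ ?_
    rintro s (hs | rfl)
    · refine LDvd.trans (hd.2.2 s hs.2 ?_) ⟨y * t, mul_assoc _ _ _⟩
      exact (hlcm.1 s (Or.inl hs)).trans he.2.1
    · exact hrt.trans htx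
  have hvy : LDvd v (y * t) := LDvd.of_mul_left (c := d) (by rwa [← mul_assoc])
  have hrib := isRibbon_of_head_mul hP hR.1 hd he hPR
  have hPv : IsStdParabolic (conjSubmonoid P v) :=
    conjSubmonoid_head_mul hP hd v ▸ isStdParabolic_conjSubmonoid hP hR.1 he hPR
  refine ⟨R, v, hR.1, hPR, he, ?_, (hrib.mul_ldvd hPv G hy ⟨t, rfl⟩ hvy).of_mul_left⟩
  rintro rfl
  refine hr.1 (hred r (hP.factor_closed r d hd.1 ?_) hrt)
  simpa using (hlcm.1 r (Or.inr rfl)).isFactor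

theorem conjSet_of_pReduced {G : GarsideStruct M} (hA : Assumption1 G) {Q : Submonoid M} {dQ c : M}
    (hQ : IsStdParabolic Q) (hdQ : IsLeftHead (Q : Set M) G.Δ dQ) (hcQ : c ∈ Q) (t : M) :
    ∀ (P : Submonoid M) (d y : M), IsStdParabolic P → IsLeftHead (P : Set M) G.Δ d →
      PReduced (P : Set M) t → y ∈ P → d * y * t = t * c →
      ConjSetDef (P : Set M) t ∧ conjSet (P : Set M) t ⊆ Q ∧
        (LDvd dQ c → conjSet (P : Set M) t = Q) := by
  induction t using G.induction_proper_factor with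
  | h t ih =>
  intro P d y hP hd hred hy hconj
  by_cases ht : t = 1
  · subst ht
    rw [mul_one, one_mul] at hconj
    have hset : conjSet (P : Set M) (1 : M) = P := by
      ext x; simp [conjSet]
    have hPQ : P ≤ Q := hd.le_of_mem hP hQ
      (hQ.factor_closed d c hcQ (LDvd.isFactor ⟨y, hconj.symm⟩))
    rw [hset]
    refine ⟨fun p _ => ⟨p, by simp⟩, hPQ, fun hdvd => le_antisymm hPQ ?_⟩
    exact hdQ.le_of_mem hQ hP
      (hP.factor_closed dQ c (hconj ▸ P.mul_mem hd.1 hy) hdvd.isFactor)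
  obtain ⟨R, v, hR, hPR, he, hv1, t', rfl⟩ :=
    exists_head_mul_ldvd hA hP hd ht hred hy ⟨c, hconj⟩
  have hrib := isRibbon_of_head_mul hP hR hd he hPR
  have hPv : IsStdParabolic (conjSubmonoid P v) :=
    conjSubmonoid_head_mul hP hd v ▸ isStdParabolic_conjSubmonoid hP hR he hPR
  obtain ⟨d', hd'⟩ := hrib.2 d hd.1
  obtain ⟨y', hy'⟩ := hrib.2 y hy
  have hne : t' ≠ v * t' := fun h => hv1 (mul_right_cancel (b := t') (by rw [← h, one_mul]))
  obtain ⟨hdef, hsub, heq⟩ := ih t' (RDvd.isFactor ⟨v, rfl⟩) hne (conjSubmonoid P v) d' y' hPv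
    (isLeftHead_conjSubmonoid hP hR hd he hPR hd')
    (by
      rintro q ⟨p, hp, hpq⟩ hqt
      have hpvt : LDvd p (v * t') :=
        LDvd.trans ⟨v, rfl⟩ (hpq ▸ hqt.mul_left v : LDvd (p * v) (v * t'))
      rw [hred p hp hpvt, one_mul] at hpq
      exact mul_left_cancel (a := v) (by rw [← hpq, mul_one]))
    ⟨y, hy, hy'⟩
    (mul_left_cancel (a := v) (by
      rw [← mul_assoc v t', ← hconj, ← mul_assoc, ← mul_assoc v d', ← hd', mul_assoc d v, ← hy']
      simp only [mul_assoc]))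
  have hset : conjSet (P : Set M) (v * t') = conjSet (conjSubmonoid P v : Set M) t' := by
    ext x
    constructor
    · rintro ⟨p, hp, hpx⟩
      obtain ⟨q, hq⟩ := hrib.2 p hp
      refine ⟨q, ⟨p, hp, hq⟩, mul_left_cancel (a := v) ?_⟩
      rw [← mul_assoc, ← hq, mul_assoc, hpx, mul_assoc]
    · rintro ⟨q, ⟨p, hp, hq⟩, hqx⟩
      exact ⟨p, hp, by rw [← mul_assoc, hq, mul_assoc, hqx, mul_assoc]⟩
  rw [hset]
  refine ⟨fun p hp => ?_, hsub, heq⟩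
  obtain ⟨q, hq⟩ := hrib.2 p hp
  rw [← mul_assoc, hq, mul_assoc]
  exact (hdef q ⟨p, hp, hq⟩).mul_left v

/-- Over `Δ_P`-powers, conjugation by `h * t` with `h ∈ P` yields conjugation by `t` of
a multiple of `Δ_P` in `P`. -/
theorem exists_conj_tail {G : GarsideStruct M} {P : Submonoid M} {d h t c : M} {k : ℕ}
    (hP : IsStdParabolic P) (hd : IsLeftHead (P : Set M) G.Δ d) (hk : 0 < k) (hh : h ∈ P)
    (hconj : d ^ k * (h * t) = h * t * c) :
    ∃ n : ℕ, ∃ y ∈ P, d * y * t = t * c ^ (n + 1) := by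
  obtain ⟨m, u, hu⟩ := hd.exists_ldvd_pow hP hh
  have hpow : ∀ n : ℕ, d ^ (k * n) * (h * t) = h * t * c ^ n := fun n => by
    rw [pow_mul]
    exact ((show SemiconjBy (h * t) c (d ^ k) from hconj.symm).pow_right n).eq.symm
  obtain ⟨j, hj⟩ := Nat.exists_eq_add_of_le
    (show m + 1 ≤ k * (m + 1) from Nat.le_mul_of_pos_left _ hk)
  have huP : u ∈ P := hP.factor_closed u _ (P.pow_mem hd.1 m) (RDvd.isFactor ⟨h, hu⟩)
  obtain ⟨u', hu'P, hu'⟩ := hd.exists_conj hP huP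
  refine ⟨m, u' * d ^ j * h, P.mul_mem (P.mul_mem hu'P (P.pow_mem hd.1 j)) hh,
    mul_left_cancel (a := h) ?_⟩
  rw [← mul_assoc h t, ← hpow, hj, pow_add, pow_succ, hu]
  simp only [mul_assoc]
  rw [← mul_assoc u, hu', mul_assoc]

/-- if `(Δ_P ^ k) ^ g` is defined and lies in `Q` (for some
`k > 0`), then `T_P(g)` is a `P`-ribbon and `P ^ {T_P(g)} ⊆ Q`; if moreover
`(Δ_P ^ k) ^ g = Δ_Q ^ k` then `P ^ {T_P(g)} = Q`. -/
theorem statement16 (G : GarsideStruct M) (hA : Assumption1 G)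
    (P Q : Submonoid M) (hP : IsStdParabolic P) (hQ : IsStdParabolic Q)
    (dP dQ : M) (hdP : IsLeftHead (P : Set M) G.Δ dP)
    (hdQ : IsLeftHead (Q : Set M) G.Δ dQ)
    (g c : M) (k : ℕ) (hk : 0 < k)
    (hconj : dP ^ k * g = g * c) (hcQ : c ∈ Q)
    (hd t : M) (hhd : IsLeftHead (P : Set M) g hd) (ht : g = hd * t) :
    IsRibbon (P : Set M) t ∧
    conjSet (P : Set M) t ⊆ (Q : Set M) ∧
    (c = dQ ^ k → conjSet (P : Set M) t = (Q : Set M)) := by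
  obtain ⟨n, y, hy, hconj'⟩ := exists_conj_tail hP hdP hk hhd.1 (ht ▸ hconj)
  have hred := hhd.pReduced_tail G ht
  obtain ⟨hdef, hsub, heq⟩ :=
    conjSet_of_pReduced hA hQ hdQ (Q.pow_mem hcQ (n + 1)) t P dP y hP hdP hred hy hconj'
  refine ⟨⟨hred, hdef⟩, hsub, fun hc => heq ?_⟩
  obtain ⟨j, rfl⟩ := Nat.exists_eq_succ_of_ne_zero hk.ne'
  rw [hc, pow_succ', pow_succ', mul_assoc]
  exact ldvd_mul_right _ _

end GarsidePaper
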